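/- Let n and h be positive integers and m a non-negative integer with h ≤ n − m. Then, as an identity in the field of rational functions Q(q, a, c): ∑_{j=0}^{m} ∑_{k=m+h}^{n} (q^{-n};q)_j (q^{-n};q)_k (a;q)_j (a;q)_k (1-q^{k-j}) q^{j+k+jh} [k-m-1 choose h-1]_q [m+h-j-1 choose h-1]_q / ((q;q)_j (q;q)_k (c;q)_j (c;q)_k) = (-1)^{m-h} (q;q)_n (a;q)_{m+h} (c/a;q)_{n-h} a^{n-h} q^{(m^2+m-h^2+h)/2 - mn} / ((q;q)_m (c;q)_m (c;q)_n (q;q)_{h-1} (q;q)_{n-m-h}). -/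

import Mathlib

open Finset

/-- The q-Pochhammer symbol `(a;q)_n = ∏_{j=0}^{n-1} (1 - a q^j)`. -/
noncomputable def qPoch {F : Type*} [Field F] (q a : F) (n : ℕ) : F :=
  ∏ j ∈ Finset.range n, (1 - a * q ^ j)

/-- The q-binomial coefficient `[n choose k]_q`, which is
`(q;q)_n / ((q;q)_k (q;q)_{n-k})` for `0 ≤ k ≤ n` and `0` otherwise. -/
noncomputable def qBin {F : Type*} [Field F] (q : F) (n k : ℕ) : F :=
  if k ≤ n then qPoch q q n / (qPoch q q k * qPoch q q (n - k)) else 0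

/-- The field of rational functions `ℚ(q, a, c)`. -/
abbrev F3 : Type := FractionRing (MvPolynomial (Fin 3) ℚ)

noncomputable def q : F3 := algebraMap (MvPolynomial (Fin 3) ℚ) F3 (MvPolynomial.X 0)
noncomputable def a : F3 := algebraMap (MvPolynomial (Fin 3) ℚ) F3 (MvPolynomial.X 1)
noncomputable def c : F3 := algebraMap (MvPolynomial (Fin 3) ℚ) F3 (MvPolynomial.X 2)

section Aux
variable {F : Type*} [Field F]

theorem qPoch_succ (q a : F) (n : ℕ) : qPoch q a (n+1) = qPoch q a n * (1 - a * q^n) := by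
  simp [qPoch, Finset.prod_range_succ]

theorem qPoch_zero (q a : F) : qPoch q a 0 = 1 := by simp [qPoch]

theorem qPoch_succ' (q a : F) (n : ℕ) : qPoch q a (n+1) = (1 - a) * qPoch q (a*q) n := by
  simp only [qPoch, Finset.prod_range_succ']
  rw [mul_comm]; congr 1
  · simp
  · apply Finset.prod_congr rfl; intros; ring

theorem qPoch_add (q a : F) (m n : ℕ) :
    qPoch q a (m+n) = qPoch q a m * qPoch q (a*q^m) n := by
  simp only [qPoch, Finset.prod_range_add]
  congr 1
  apply Finset.prod_congr rfl; intros; ring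

theorem qPoch_ne (q a : F) (hc : ∀ i, a * q^i ≠ 1) (n : ℕ) : qPoch q a n ≠ 0 := by
  rw [qPoch, Finset.prod_ne_zero_iff]
  intro i _ h
  exact hc i (sub_eq_zero.mp h).symm

/-- finite q-binomial theorem -/
theorem qbinom_sum (q : F) (hq0 : q ≠ 0) (hq1 : ∀ i, q * q^i ≠ 1) (z : F) (n : ℕ) :
    ∑ k ∈ range (n+1), qPoch q ((q^n)⁻¹) k / qPoch q q k * z^k
      = ∏ i ∈ range n, (1 - z * (q^(i+1))⁻¹) := by
  induction n with
  | zero => simp [qPoch_zero]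
  | succ n ih =>
    rw [Finset.prod_range_succ, ← ih]
    have h1 : ∑ k ∈ range (n+1), qPoch q ((q^n)⁻¹) k / qPoch q q k * z^k
       = ∑ k ∈ range (n+2), qPoch q ((q^n)⁻¹) k / qPoch q q k * z^k := by
      rw [Finset.sum_range_succ _ (n+1), qPoch_succ]
      simp [hq0]
    rw [mul_sub, mul_one]
    nth_rewrite 1 [h1]
    rw [Finset.sum_range_succ' _ (n+1), Finset.sum_range_succ' _ (n+1), Finset.sum_mul]
    simp only [qPoch_zero]
    rw [add_sub_right_comm, ← Finset.sum_sub_distrib]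
    congr 1
    apply Finset.sum_congr rfl
    intro k _
    rw [qPoch_succ' q ((q^(n+1))⁻¹), qPoch_succ q ((q^n)⁻¹) k, qPoch_succ q q k]
    have e : (q^(n+1))⁻¹ * q = (q^n)⁻¹ := by field_simp; ring
    rw [e]
    have h2 := qPoch_ne q q hq1 k
    have h3 : 1 - q * q^k ≠ 0 := fun h => hq1 k (sub_eq_zero.mp h).symm
    field_simp
    ring

theorem mono_vanish (q : F) (hq0 : q ≠ 0) (hq1 : ∀ i, q * q^i ≠ 1) (n d : ℕ) (hd : d < n) :
    ∑ k ∈ range (n+1), qPoch q ((q^n)⁻¹) k / qPoch q q k * q^k * (q^k)^d = 0 := by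
  have := qbinom_sum q hq0 hq1 (q^(d+1)) n
  rw [Finset.prod_eq_zero (i := d) (by simpa using hd) (by
    rw [mul_inv_cancel₀ (pow_ne_zero _ hq0), sub_self])] at this
  rw [← this]
  apply Finset.sum_congr rfl
  intro k _
  ring

theorem poly_vanish (q : F) (hq0 : q ≠ 0) (hq1 : ∀ i, q * q^i ≠ 1) (n : ℕ)
    (p : Polynomial F) (hp : p.natDegree < n) :
    ∑ k ∈ range (n+1), qPoch q ((q^n)⁻¹) k / qPoch q q k * q^k * p.eval (q^k) = 0 := by
  simp only [Polynomial.eval_eq_sum_range, Finset.mul_sum]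
  rw [Finset.sum_comm]
  apply Finset.sum_eq_zero
  intro d hd
  have := mono_vanish q hq0 hq1 n d (by simp at hd; omega)
  calc _ = p.coeff d * ∑ k ∈ range (n+1), qPoch q ((q^n)⁻¹) k / qPoch q q k * q^k * (q^k)^d := by
        rw [Finset.mul_sum]; apply Finset.sum_congr rfl; intros; ring
    _ = 0 := by rw [this, mul_zero]

theorem anti_sum (n m h : ℕ) (hmn : m + h ≤ n) (hh : 0 < h) (W x : ℕ → F)
    (hW : ∀ k, m < k → k < m + h → W k = 0)
    (h0 : ∑ k ∈ range (n+1), W k = 0) (h1 : ∑ k ∈ range (n+1), W k * x k = 0) :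
    ∑ j ∈ range (m+1), ∑ k ∈ Icc (m+h) n, (x j - x k) * (W j * W k) = 0 := by
  have key : ∀ g : ℕ → F, (∀ k, m < k → k < m + h → g k = 0) → 
      ∑ k ∈ range (n+1), g k = ∑ k ∈ range (m+1), g k + ∑ k ∈ Icc (m+h) n, g k := by
    intro g hg
    rw [← Finset.sum_union]
    · symm
      apply Finset.sum_subset
      · intro k; simp; omega
      · intro k hk hk'
        simp at hk hk'
        apply hg <;> omega
    · rw [Finset.disjoint_left]; intro k; simp; omega
  rw [key _ hW] at h0
  rw [key _ (fun k a b => by rw [hW k a b, zero_mul])] at h1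
  have : ∑ j ∈ range (m+1), ∑ k ∈ Icc (m+h) n, (x j - x k) * (W j * W k)
      = (∑ j ∈ range (m+1), W j * x j) * (∑ k ∈ Icc (m+h) n, W k)
        - (∑ j ∈ range (m+1), W j) * (∑ k ∈ Icc (m+h) n, W k * x k) := by
    rw [Finset.sum_mul_sum, Finset.sum_mul_sum, ← Finset.sum_sub_distrib]
    apply Finset.sum_congr rfl; intro j _
    rw [← Finset.sum_sub_distrib]
    apply Finset.sum_congr rfl; intro k _
    ring
  rw [this]
  linear_combination (∑ j ∈ range (m+1), W j * x j) * h0 - (∑ j ∈ range (m+1), W j) * h1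

/-- the nodal polynomial -/
noncomputable def fP (q : F) (m h : ℕ) : Polynomial F :=
  ∏ i ∈ range (h-1), (Polynomial.X - Polynomial.C (q^(m+1+i)))

theorem bin_k (q : F) (hq0 : q ≠ 0) (hq1 : ∀ i, q * q^i ≠ 1) (m h k : ℕ) (hh : 0 < h)
    (hk : m + h ≤ k) :
    qBin q (k-m-1) (h-1) = (∏ i ∈ range (h-1), (-(q^(m+1+i))⁻¹)) / qPoch q q (h-1)
      * (fP q m h).eval (q^k) := by
  obtain ⟨s, rfl⟩ := Nat.exists_eq_add_of_le hk
  obtain ⟨r, rfl⟩ : ∃ r, h = r + 1 := ⟨h-1, by omega⟩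
  have e1 : m + (r+1) + s - m - 1 = s + r := by omega
  rw [e1, qBin, if_pos (by omega)]
  simp only [Nat.add_sub_cancel]
  rw [qPoch_add, fP, Polynomial.eval_prod, Nat.add_sub_cancel, div_mul_eq_mul_div,
    ← Finset.prod_mul_distrib]
  have h1 := qPoch_ne q q hq1 s
  have h2 := qPoch_ne q q hq1 r
  have : qPoch q (q*q^s) r = ∏ x ∈ range r,
      -(q ^ (m + 1 + x))⁻¹ * Polynomial.eval (q ^ (m + (r + 1) + s)) (Polynomial.X - Polynomial.C (q ^ (m + 1 + x))) := by
    rw [qPoch, ← Finset.prod_range_reflect]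
    apply Finset.prod_congr rfl
    intro x hx
    simp at hx
    obtain ⟨t, rfl⟩ : ∃ t, r = x + 1 + t := ⟨r - x - 1, by omega⟩
    have : x + 1 + t - 1 - x = t := by omega
    rw [this]
    simp
    field_simp
    ring
  rw [← this]
  field_simp

theorem bin_j (q : F) (hq0 : q ≠ 0) (hq1 : ∀ i, q * q^i ≠ 1) (m h j : ℕ) (hh : 0 < h)
    (hj : j ≤ m) :
    q^(j*(h-1)) * qBin q (m+h-j-1) (h-1) = (fP q m h).eval (q^j) / qPoch q q (h-1) := by
  obtain ⟨s, rfl⟩ := Nat.exists_eq_add_of_le hj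
  obtain ⟨r, rfl⟩ : ∃ r, h = r + 1 := ⟨h-1, by omega⟩
  have e1 : j + s + (r+1) - j - 1 = s + r := by omega
  rw [e1, qBin, if_pos (by omega)]
  simp only [Nat.add_sub_cancel]
  rw [qPoch_add, fP, Polynomial.eval_prod, Nat.add_sub_cancel]
  have h1 := qPoch_ne q q hq1 s
  have h2 := qPoch_ne q q hq1 r
  have : ∏ x ∈ range r, Polynomial.eval (q^j) (Polynomial.X - Polynomial.C (q ^ (j + s + 1 + x)))
     = q^(j*r) * qPoch q (q*q^s) r := by
    rw [qPoch, pow_mul, ← Finset.card_range r, ← Finset.prod_const, Finset.card_range,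
      ← Finset.prod_mul_distrib]
    apply Finset.prod_congr rfl
    intro x hx
    simp
    ring
  rw [this]
  field_simp

theorem fP_vanish (q : F) (m h k : ℕ) (h1 : m < k) (h2 : k < m + h) :
    (fP q m h).eval (q^k) = 0 := by
  rw [fP, Polynomial.eval_prod]
  apply Finset.prod_eq_zero (i := k - m - 1)
  · simp; omega
  · have : m + 1 + (k - m - 1) = k := by omega
    simp [this]

theorem fP_deg (q : F) (m h : ℕ) : (fP q m h).natDegree ≤ h - 1 := by
  rw [fP]
  refine (Polynomial.natDegree_prod_le _ _).trans ?_
  simp only [Polynomial.natDegree_X_sub_C]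
  simp

/-- the coefficient of `(a)_j (a)_k` -/
noncomputable def eC (q c : F) (n h m j k : ℕ) : F :=
  qPoch q ((q ^ n)⁻¹) j * qPoch q ((q ^ n)⁻¹) k *
          (1 - q ^ ((k : ℤ) - j)) * q ^ (j + k + j * h) *
          qBin q (k - m - 1) (h - 1) * qBin q (m + h - j - 1) (h - 1) /
          (qPoch q q j * qPoch q q k * qPoch q c j * qPoch q c k)

theorem eC_eq (q c : F) (hq0 : q ≠ 0) (hq1 : ∀ i, q * q^i ≠ 1)
    (n h m j k : ℕ) (hh : 0 < h) (hj : j ≤ m) (hk : m + h ≤ k) :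
    eC q c n h m j k = (∏ i ∈ range (h-1), (-(q^(m+1+i))⁻¹)) / qPoch q q (h-1) / qPoch q q (h-1) *
      ((q^j - q^k) * ((qPoch q ((q ^ n)⁻¹) j / qPoch q q j * q^j * (fP q m h).eval (q^j) / qPoch q c j)
       * (qPoch q ((q ^ n)⁻¹) k / qPoch q q k * q^k * (fP q m h).eval (q^k) / qPoch q c k))) := by
  have h1 := bin_k q hq0 hq1 m h k hh hk
  have h2 := bin_j q hq0 hq1 m h j hh hj
  have h3 : (1 - q ^ ((k : ℤ) - j)) * q ^ (j + k + j * h) = (q^j - q^k) * q^j * q^k * q^(j*(h-1)) := by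
    obtain ⟨s, rfl⟩ : ∃ s, k = j + s := ⟨k - j, by omega⟩
    obtain ⟨r, rfl⟩ : ∃ r, h = r + 1 := ⟨h-1, by omega⟩
    have : ((j + s : ℕ) : ℤ) - j = (s : ℕ) := by push_cast; ring
    rw [this, zpow_natCast]
    simp only [Nat.add_sub_cancel]
    ring
  have : eC q c n h m j k = qPoch q ((q ^ n)⁻¹) j * qPoch q ((q ^ n)⁻¹) k *
    ((1 - q ^ ((k : ℤ) - j)) * q ^ (j + k + j * h)) * qBin q (k - m - 1) (h - 1) * qBin q (m + h - j - 1) (h - 1) /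
          (qPoch q q j * qPoch q q k * qPoch q c j * qPoch q c k) := by
    rw [eC]; ring
  rw [this, h3, h1]
  have : Polynomial.eval (q^j) (fP q m h) / qPoch q q (h-1) / qPoch q q (h-1) =
     (q^(j*(h-1)) * qBin q (m+h-j-1) (h-1)) / qPoch q q (h-1) := by rw [h2]
  have h4 := qPoch_ne q q hq1 (h-1)
  rw [mul_assoc, mul_assoc] at *
  trans (∏ i ∈ range (h-1), (-(q^(m+1+i))⁻¹)) * (q^j-q^k) * qPoch q ((q ^ n)⁻¹) j / qPoch q q j * q^j / qPoch q c j
       * (qPoch q ((q ^ n)⁻¹) k / qPoch q q k * q^k * (fP q m h).eval (q^k) / qPoch q c k) * 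
       ((q^(j*(h-1)) * qBin q (m+h-j-1) (h-1)) / qPoch q q (h-1))
  · ring
  · rw [h2]; ring

theorem shift_c (q c : F) (hc : ∀ i, c * q^i ≠ 1) (i j : ℕ) :
    qPoch q (c*q^i) j / qPoch q c j = qPoch q (c*q^j) i / qPoch q c i := by
  rw [div_eq_div_iff (qPoch_ne q c hc j) (qPoch_ne q c hc i)]
  rw [mul_comm, ← qPoch_add, mul_comm, ← qPoch_add, add_comm]

theorem zero_c (q c : F) (hq0 : q ≠ 0) (hq1 : ∀ i, q * q^i ≠ 1) (hc : ∀ i, c * q^i ≠ 1)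
    (n h m i : ℕ) (hh : 0 < h) (hmn : m + h ≤ n) (hi : i < n - h) :
    ∑ j ∈ range (m+1), ∑ k ∈ Icc (m+h) n,
      eC q c n h m j k * (qPoch q (c*q^i) j * qPoch q (c*q^i) k) = 0 := by
  let g : Polynomial F := ∏ l ∈ range i, (1 - Polynomial.C (c*q^l) * Polynomial.X)
  have hg : ∀ j, g.eval (q^j) = qPoch q (c*q^j) i := by
    intro j
    simp only [g, Polynomial.eval_prod, qPoch]
    apply Finset.prod_congr rfl
    intros; simp; ring
  have hgd : g.natDegree ≤ i := by
    refine (Polynomial.natDegree_prod_le _ _).trans ?_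
    refine (Finset.sum_le_card_nsmul _ _ 1 ?_).trans (by simp)
    intro l _
    compute_degree
  let W : ℕ → F := fun k => qPoch q ((q^n)⁻¹) k / qPoch q q k * q^k * ((fP q m h) * g).eval (q^k)
  have hd := fP_deg q m h
  have hd2 : (fP q m h * g).natDegree ≤ (h-1) + i :=
    Polynomial.natDegree_mul_le.trans (by omega)
  have h0 := poly_vanish q hq0 hq1 n (fP q m h * g) (by omega)
  have h1 := poly_vanish q hq0 hq1 n (fP q m h * g * Polynomial.X) (by
    refine lt_of_le_of_lt Polynomial.natDegree_mul_le ?_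
    rw [Polynomial.natDegree_X]; omega)
  have := anti_sum n m h hmn hh W (fun k => q^k)
    (fun k a b => by simp [W, fP_vanish q m h k a b]) h0
    (by rw [← h1]; apply Finset.sum_congr rfl; intro k _; simp [W]; ring)
  trans (∏ i ∈ range (h-1), (-(q^(m+1+i))⁻¹)) / qPoch q q (h-1) / qPoch q q (h-1) / qPoch q c i / qPoch q c i * 
    ∑ j ∈ range (m+1), ∑ k ∈ Icc (m+h) n, (q^j - q^k) * (W j * W k)
  · rw [Finset.mul_sum]
    apply Finset.sum_congr rfl; intro j hj
    rw [Finset.mul_sum]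
    apply Finset.sum_congr rfl; intro k hk
    simp at hj hk
    rw [eC_eq q c hq0 hq1 n h m j k hh (by omega) (by omega)]
    have e1 := shift_c q c hc i j
    have e2 := shift_c q c hc i k
    simp only [W, Polynomial.eval_mul, hg]
    linear_combination (exp := 1) (∏ i ∈ range (h-1), (-(q^(m+1+i))⁻¹)) / qPoch q q (h-1) / qPoch q q (h-1) *
      ((q^j - q^k) * ((qPoch q ((q ^ n)⁻¹) j / qPoch q q j * q^j * (fP q m h).eval (q^j))
       * (qPoch q ((q ^ n)⁻¹) k / qPoch q q k * q^k * (fP q m h).eval (q^k)))) * (qPoch q (c*q^i) k / qPoch q c k * e1 + qPoch q (c*q^j) i / qPoch q c i * e2)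
  · rw [this, mul_zero]

/-- `(X;q)_n` as a polynomial -/
noncomputable def pP (q : F) (n : ℕ) : Polynomial F :=
  ∏ j ∈ range n, (1 - Polynomial.C (q^j) * Polynomial.X)

theorem pP_eval (q a : F) (n : ℕ) : (pP q n).eval a = qPoch q a n := by
  simp only [pP, qPoch, Polynomial.eval_prod]
  apply Finset.prod_congr rfl
  intros; simp; ring

theorem pP_deg (q : F) (n : ℕ) : (pP q n).natDegree ≤ n := by
  refine (Polynomial.natDegree_prod_le _ _).trans ?_
  refine (Finset.sum_le_card_nsmul _ _ 1 ?_).trans (by simp)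
  intro l _
  compute_degree

theorem pP_coeff (q : F) (n : ℕ) : (pP q n).coeff n = (-1)^n * q^(n.choose 2) := by
  induction n with
  | zero => simp [pP]
  | succ n ih =>
    have : pP q (n+1) = pP q n * (1 - Polynomial.C (q^n) * Polynomial.X) := by
      simp [pP, Finset.prod_range_succ]
    rw [this, Polynomial.coeff_mul_add_eq_of_natDegree_le (pP_deg q n) (by compute_degree), ih,
      Nat.choose_succ_succ' n 1]
    rw [Polynomial.coeff_sub, Polynomial.coeff_C_mul, Polynomial.coeff_X_one, Polynomial.coeff_one]
    simp only [one_ne_zero, if_false, Nat.choose_one_right]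
    ring

theorem neg_poch (q : F) (hq0 : q ≠ 0) (n m : ℕ) (hm : m ≤ n) :
    qPoch q ((q^n)⁻¹) m * qPoch q q (n-m) * q^(n*m) = (-1)^m * q^(m.choose 2) * qPoch q q n := by
  induction m with
  | zero => simp [qPoch_zero]
  | succ m ih =>
    have ih := ih (by omega)
    obtain ⟨s, rfl⟩ : ∃ s, n = m + 1 + s := ⟨n - m - 1, by omega⟩
    have e1 : m + 1 + s - m = s + 1 := by omega
    have e2 : m + 1 + s - (m+1) = s := by omega
    rw [e1, qPoch_succ] at ih
    rw [e2, qPoch_succ, Nat.choose_succ_succ' m 1]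
    have : (1 - (q^(m+1+s))⁻¹ * q^m) * q^(m+1+s) = - q^m * (1 - q * q^s) := by
      field_simp; ring
    rw [Nat.choose_one_right, mul_add, pow_add q _ (_ * 1), mul_one]
    calc _ = qPoch q (q ^ (m + 1 + s))⁻¹ m * qPoch q q s * q ^ ((m + 1 + s) * m) * ((1 - (q^(m+1+s))⁻¹ * q^m) * q^(m+1+s)) := by ring
      _ = (qPoch q (q ^ (m + 1 + s))⁻¹ m * (qPoch q q s * (1 - q * q ^ s)) * q ^ ((m + 1 + s) * m)) * (- q^m) := by rw [this]; ring
      _ = _ := by rw [ih]; ring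

/-- the constant on the right -/
noncomputable def rC (q c : F) (n h m : ℕ) : F :=
  (-1 : F) ^ ((m : ℤ) - h) * qPoch q q n * q ^ ((((m : ℤ) ^ 2 + m - (h : ℤ) ^ 2 + h) / 2) - m * n) /
      (qPoch q q m * qPoch q c m * qPoch q c n * qPoch q q (h - 1) * qPoch q q (n - m - h))

theorem lead_eq (q c : F) (hq0 : q ≠ 0) (hq1 : ∀ i, q * q^i ≠ 1) (hc : ∀ i, c * q^i ≠ 1)
    (n h m : ℕ) (hh : 0 < h) (hmn : m + h ≤ n) :
    eC q c n h m m n * (((-1)^m * q^(m.choose 2)) * ((-1)^n * q^(n.choose 2)))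
      = rC q c n h m * ((-1)^(m+h) * q^((m+h).choose 2)) := by
  have hA := neg_poch q hq0 n m (by omega)
  have hB := neg_poch q hq0 n n le_rfl
  rw [Nat.sub_self, qPoch_zero, mul_one] at hB
  obtain ⟨s, rfl⟩ := Nat.exists_eq_add_of_le hmn
  obtain ⟨r, rfl⟩ : ∃ r, h = r + 1 := ⟨h-1, by omega⟩
  have e1 : m + (r+1) + s - m = s + r + 1 := by omega
  have e2 : m + (r+1) + s - m - 1 = s + r := by omega
  have e3 : m + (r+1) + s - m - (r+1) = s := by omega
  have e4 : m + (r+1) - m - 1 = r := by omega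
  have e5 : r + 1 - 1 = r := by omega
  have e6 : s + r - r = s := by omega
  have e7 : ((m + (r+1) + s : ℕ) : ℤ) - m = (s + r + 1 : ℕ) := by push_cast; ring
  have hE : ((m : ℤ) ^ 2 + m - ((r+1 : ℕ) : ℤ) ^ 2 + ((r+1 : ℕ) : ℤ)) / 2
      = ((m+1).choose 2 : ℤ) - ((r+1).choose 2 : ℤ) := by
    have c1 := Nat.choose_two_right (m+1)
    have c2 := Nat.choose_two_right (r+1)
    have d1 : 2 * ((m+1).choose 2) = (m+1)*m := by
      rw [Nat.choose_two_right, Nat.mul_div_cancel' (Nat.even_mul_pred_self _).two_dvd]; rfl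
    have d2 : 2 * ((r+1).choose 2) = (r+1)*r := by
      rw [Nat.choose_two_right, Nat.mul_div_cancel' (Nat.even_mul_pred_self _).two_dvd]; rfl
    apply Int.ediv_eq_of_eq_mul_right (by norm_num)
    zify at d1 d2
    push_cast
    linear_combination d2 - d1
  rw [eC, rC, e2, e3, e4, e5, e7, hE, qBin, qBin, if_pos (by omega), if_pos le_rfl, e6, Nat.sub_self,
    qPoch_zero, zpow_natCast]
  rw [e1, qPoch_succ] at hA
  have p1 := qPoch_ne q q hq1 s
  have p2 := qPoch_ne q q hq1 r
  have p3 := qPoch_ne q q hq1 (s+r)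
  have p4 := qPoch_ne q q hq1 m
  have p5 := qPoch_ne q q hq1 (m+(r+1)+s)
  have p6 := qPoch_ne q c hc m
  have p7 := qPoch_ne q c hc (m+(r+1)+s)
  set N := m + (r+1) + s with hN
  have hz : q ^ (((m+1).choose 2 : ℤ) - ((r+1).choose 2 : ℤ) - m * N)
     = q^((m+1).choose 2) / q^((r+1).choose 2) / q^(N*m) := by
    rw [zpow_sub₀ hq0, zpow_sub₀ hq0]
    norm_cast
    rw [mul_comm m N]
  have hs : (-1 : F) ^ ((m:ℤ) - ((r+1 : ℕ):ℤ)) = (-1)^m * (-1)^(r+1) := by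
    rw [zpow_sub₀ (by simp)]
    rw [zpow_natCast, zpow_natCast, div_eq_mul_inv, ← inv_pow]
    norm_num
  rw [hz, hs]
  have X1 : qPoch q (q^N)⁻¹ m * (qPoch q q (s+r) * (1 - q * q^(s+r)))  
      = (-1)^m * q^(m.choose 2) * qPoch q q N / q^(N*m) := by
    rw [← hA]; field_simp
  have X2 : qPoch q (q^N)⁻¹ N = (-1)^N * q^(N.choose 2) * qPoch q q N / q^(N*N) := by
    rw [← hB]; field_simp
  have sg : ∀ k, ((-1:F)^k)*((-1)^k) = 1 := by
    intro k; rw [← mul_pow]; simp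
  have ex : q^(m.choose 2) * q^(N.choose 2) * q^(m + N + m*(r+1)) * q^(m.choose 2) * q^(N.choose 2) * q^((r+1).choose 2)
      = q^((m+1).choose 2) * q^((m+(r+1)).choose 2) * q^(N*N) := by
    simp only [← pow_add]
    congr 1
    have d : ∀ k : ℕ, 2 * (k.choose 2 : ℤ) = k*(k-1) := by
      intro k
      have : 2 * (k.choose 2) = k * (k-1) := by
        rw [Nat.choose_two_right, Nat.mul_div_cancel' (Nat.even_mul_pred_self _).two_dvd]
      rcases k with _ | k
      · simp
      · zify at this; simpa using this
    have d1 := d m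
    have d2 := d N
    have d3 := d (r+1)
    have d4 := d (m+1)
    have d5 := d (m+(r+1))
    zify
    push_cast at d1 d2 d3 d4 d5 ⊢
    linarith
  trans (qPoch q (q^N)⁻¹ m * (qPoch q q (s+r) * (1 - q * q^(s+r)))) * qPoch q (q^N)⁻¹ N * q^(m + N + m*(r+1)) * ((-1) ^ m * q ^ m.choose 2 * ((-1) ^ N * q ^ N.choose 2)) / (qPoch q q r * qPoch q q s * qPoch q q m * qPoch q q N * qPoch q c m * qPoch q c N)
  · field_simp
    try ring
  · rw [X1, X2]
    trans (((-1:F)^m*(-1)^m)*((-1)^N*(-1)^N)) * qPoch q q N * (q^(m.choose 2) * q^(N.choose 2) * q^(m + N + m*(r+1)) * q^(m.choose 2) * q^(N.choose 2) * q^((r+1).choose 2)) / (q^(N*m) * q^(N*N) * q^((r+1).choose 2) * (qPoch q q r * qPoch q q s * qPoch q q m * qPoch q c m * qPoch q c N))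
    · field_simp
    · rw [ex, pow_add (-1 : F) m (r+1)]
      trans (((-1:F)^m*(-1)^m)*((-1)^(r+1)*(-1)^(r+1))) * qPoch q q N * (q ^ (m + 1).choose 2 * q ^ (m + (r + 1)).choose 2 )/ (q^(N*m) * q^((r+1).choose 2) * (qPoch q q r * qPoch q q s * qPoch q q m * qPoch q c m * qPoch q c N))
      · simp only [sg]
        field_simp
      · field_simp

theorem ca_eq (q a c : F) (ha : a ≠ 0) (n : ℕ) :
    qPoch q (c/a) n * a^n = ∏ i ∈ range n, (a - c * q^i) := by
  rw [qPoch]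
  conv_lhs => rw [← Finset.card_range n, ← Finset.prod_const, Finset.card_range]
  rw [← Finset.prod_mul_distrib]
  apply Finset.prod_congr rfl
  intros; field_simp

theorem general (q a c : F) (hq0 : q ≠ 0) (hq1 : ∀ i, q * q^i ≠ 1) (hc0 : c ≠ 0)
    (hc : ∀ i, c * q^i ≠ 1) (ha : a ≠ 0)
    (n h m : ℕ) (hh : 0 < h) (hmn : m + h ≤ n) :
    ∑ j ∈ range (m+1), ∑ k ∈ Icc (m+h) n, eC q c n h m j k * (qPoch q a j * qPoch q a k)
    = rC q c n h m * (qPoch q a (m+h) * (qPoch q (c/a) (n-h) * a^(n-h))) := by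
  let L : Polynomial F := ∑ j ∈ range (m+1), ∑ k ∈ Icc (m+h) n,
    Polynomial.C (eC q c n h m j k) * (pP q j * pP q k)
  let Q : Polynomial F := ∏ i ∈ range (n-h), (Polynomial.X - Polynomial.C (c*q^i))
  let R : Polynomial F := Polynomial.C (rC q c n h m) * (pP q (m+h) * Q)
  have hL : ∀ x, L.eval x = ∑ j ∈ range (m+1), ∑ k ∈ Icc (m+h) n,
      eC q c n h m j k * (qPoch q x j * qPoch q x k) := by
    intro x
    simp [L, Polynomial.eval_finsetSum, pP_eval]
  have hQ : ∀ x, Q.eval x = ∏ i ∈ range (n-h), (x - c*q^i) := by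
    intro x; simp [Q, Polynomial.eval_prod]
  have hR : ∀ x, R.eval x = rC q c n h m * (qPoch q x (m+h) * ∏ i ∈ range (n-h), (x - c*q^i)) := by
    intro x; simp only [R, Polynomial.eval_mul, Polynomial.eval_C, pP_eval, hQ]
  have hpp : ∀ j k, (pP q j * pP q k).natDegree ≤ j + k := fun j k =>
    Polynomial.natDegree_mul_le.trans (add_le_add (pP_deg q j) (pP_deg q k))
  have hQm : Q.Monic := Polynomial.monic_prod_of_monic _ _ (fun i _ => Polynomial.monic_X_sub_C _)
  have hQd : Q.natDegree = n - h := by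
    rw [Polynomial.natDegree_prod_of_monic _ _ (fun i _ => Polynomial.monic_X_sub_C _)]
    simp only [Polynomial.natDegree_X_sub_C]
    simp
  have hLd : L.natDegree ≤ m + n := by
    apply Polynomial.natDegree_sum_le_of_forall_le
    intro j hj
    apply Polynomial.natDegree_sum_le_of_forall_le
    intro k hk
    simp at hj hk
    exact (Polynomial.natDegree_C_mul_le _ _).trans ((hpp j k).trans (by omega))
  have hRd : R.natDegree ≤ m + n := by
    refine (Polynomial.natDegree_C_mul_le _ _).trans (Polynomial.natDegree_mul_le.trans ?_)
    have := pP_deg q (m+h)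
    omega
  have hLc : L.coeff (m+n) = eC q c n h m m n * (((-1)^m * q^(m.choose 2)) * ((-1)^n * q^(n.choose 2))) := by
    simp only [L, Polynomial.finsetSum_coeff, Polynomial.coeff_C_mul]
    rw [Finset.sum_eq_single m, Finset.sum_eq_single n,
      Polynomial.coeff_mul_add_eq_of_natDegree_le (pP_deg q m) (pP_deg q n), pP_coeff, pP_coeff]
    · intro k hk hkn
      simp at hk
      rw [Polynomial.coeff_eq_zero_of_natDegree_lt (lt_of_le_of_lt (hpp m k) (by omega)), mul_zero]
    · intro h; simp at h; omega
    · intro j hj hjm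
      apply Finset.sum_eq_zero
      intro k hk
      simp at hj hk
      rw [Polynomial.coeff_eq_zero_of_natDegree_lt (lt_of_le_of_lt (hpp j k) (by omega)), mul_zero]
    · intro h; simp at h
  have hRc : R.coeff (m+n) = rC q c n h m * ((-1)^(m+h) * q^((m+h).choose 2)) := by
    have e : m + n = (m+h) + (n-h) := by omega
    simp only [R, Polynomial.coeff_C_mul]
    rw [e, Polynomial.coeff_mul_add_eq_of_natDegree_le (pP_deg q _) hQd.le, pP_coeff]
    have : Q.coeff (n-h) = 1 := by rw [← hQd]; exact hQm
    rw [this, mul_one]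
  have hinj : ∀ i j, q^i = q^j → i = j := by
    have : ∀ i d, q^i ≠ q^(i+d+1) := by
      intro i d hd
      apply hq1 d
      have : q^i * (q*q^d) = q^i * 1 := by rw [mul_one]; refine Eq.trans ?_ hd.symm; ring
      exact mul_left_cancel₀ (pow_ne_zero _ hq0) this
    intro i j hij
    rcases lt_trichotomy i j with hl | hl | hl
    · obtain ⟨d, rfl⟩ := Nat.exists_eq_add_of_lt hl
      exact absurd hij (this _ _)
    · exact hl
    · obtain ⟨d, rfl⟩ := Nat.exists_eq_add_of_lt hl
      exact absurd hij.symm (this _ _)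
  have hpz : ∀ i k, i < k → qPoch q ((q^i)⁻¹) k = 0 := by
    intro i k hik
    rw [qPoch]
    exact Finset.prod_eq_zero (i := i) (by simpa using hik) (by
      rw [inv_mul_cancel₀ (pow_ne_zero _ hq0), sub_self])
  classical
  let s1 := (range (m+h)).image (fun i => (q^i)⁻¹)
  let s2 := (range (n-h)).image (fun i => c * q^i)
  have hs1 : s1.card = m + h := by
    rw [Finset.card_image_of_injective, Finset.card_range]
    intro i j hij
    exact hinj _ _ (inv_injective hij)
  have hs2 : s2.card = n - h := by
    rw [Finset.card_image_of_injective, Finset.card_range]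
    intro i j hij
    exact hinj _ _ (mul_left_cancel₀ hc0 hij)
  have hdis : Disjoint s1 s2 := by
    rw [Finset.disjoint_left]
    intro x h1 h2
    simp only [s1, s2, Finset.mem_image] at h1 h2
    obtain ⟨i, _, rfl⟩ := h1
    obtain ⟨j, _, hj⟩ := h2
    apply hc (j+i)
    rw [pow_add, ← mul_assoc, hj, inv_mul_cancel₀ (pow_ne_zero _ hq0)]
  have hcard : (s1 ∪ s2).card = m + n := by
    rw [Finset.card_union_of_disjoint hdis, hs1, hs2]; omega
  have hLR : L = R := by
    apply Polynomial.eq_of_degree_sub_lt_of_eval_finset_eq (s1 ∪ s2)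
    · rw [hcard, Polynomial.degree_lt_iff_coeff_zero]
      intro N hN
      rcases hN.lt_or_eq with hN | rfl
      · rw [Polynomial.coeff_sub, Polynomial.coeff_eq_zero_of_natDegree_lt (hLd.trans_lt hN),
          Polynomial.coeff_eq_zero_of_natDegree_lt (hRd.trans_lt hN), sub_zero]
      · rw [Polynomial.coeff_sub, hLc, hRc, lead_eq q c hq0 hq1 hc n h m hh hmn, sub_self]
    · intro x hx
      rw [hL, hR]
      rcases Finset.mem_union.mp hx with hx | hx
      · simp only [s1, Finset.mem_image] at hx
        obtain ⟨i, hi, rfl⟩ := hx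
        simp at hi
        rw [hpz i _ hi, zero_mul, mul_zero]
        apply Finset.sum_eq_zero; intro j _
        apply Finset.sum_eq_zero; intro k hk
        simp at hk
        rw [hpz i k (by omega), mul_zero, mul_zero]
      · simp only [s2, Finset.mem_image] at hx
        obtain ⟨i, hi, rfl⟩ := hx
        have hi' := hi
        simp at hi
        rw [zero_c q c hq0 hq1 hc n h m i hh hmn hi, Finset.prod_eq_zero hi' (sub_self _), mul_zero, mul_zero]
  rw [← hL, hLR, hR, ca_eq q a c ha]

end Aux

theorem F3_inj : Function.Injective (algebraMap (MvPolynomial (Fin 3) ℚ) F3) :=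
  IsFractionRing.injective _ _

theorem F3_mon (i : Fin 3) (k : ℕ) : algebraMap (MvPolynomial (Fin 3) ℚ) F3 (MvPolynomial.X i) *
    algebraMap (MvPolynomial (Fin 3) ℚ) F3 (MvPolynomial.X 0) ^ k ≠ 1 := by
  intro h
  rw [← map_pow, ← map_mul, ← map_one (algebraMap (MvPolynomial (Fin 3) ℚ) F3)] at h
  have := congrArg (MvPolynomial.eval (fun _ => (0:ℚ))) (F3_inj h)
  simp at this

theorem F3_ne (i : Fin 3) : algebraMap (MvPolynomial (Fin 3) ℚ) F3 (MvPolynomial.X i) ≠ 0 := by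
  intro h
  rw [← map_zero (algebraMap (MvPolynomial (Fin 3) ℚ) F3)] at h
  exact MvPolynomial.X_ne_zero i (F3_inj h)

theorem double_sum_lemma_two (n h m : ℕ) (hn : 0 < n) (hh : 0 < h) (hnm : h ≤ n - m) :
    ∑ j ∈ Finset.range (m + 1), ∑ k ∈ Finset.Icc (m + h) n,
        qPoch q ((q ^ n)⁻¹) j * qPoch q ((q ^ n)⁻¹) k * qPoch q a j * qPoch q a k *
          (1 - q ^ ((k : ℤ) - j)) * q ^ (j + k + j * h) *
          qBin q (k - m - 1) (h - 1) * qBin q (m + h - j - 1) (h - 1) /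
          (qPoch q q j * qPoch q q k * qPoch q c j * qPoch q c k) =
    (-1 : F3) ^ ((m : ℤ) - h) * qPoch q q n * qPoch q a (m + h) * qPoch q (c / a) (n - h) *
      a ^ (n - h) * q ^ ((((m : ℤ) ^ 2 + m - (h : ℤ) ^ 2 + h) / 2) - m * n) /
      (qPoch q q m * qPoch q c m * qPoch q c n * qPoch q q (h - 1) * qPoch q q (n - m - h)) := by

  have hmn : m + h ≤ n := by omega
  have := general q a c (F3_ne 0) (F3_mon 0) (F3_ne 2) (F3_mon 2) (F3_ne 1) n h m hh hmn
  trans ∑ j ∈ range (m+1), ∑ k ∈ Icc (m+h) n, eC q c n h m j k * (qPoch q a j * qPoch q a k)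
  · apply Finset.sum_congr rfl; intro j _
    apply Finset.sum_congr rfl; intro k _
    rw [eC]; ring
  · rw [this, rC]; ring
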